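/- Let K : ℝ → ℝ be Borel measurable, bounded, compactly supported, and symmetric (K(−u) = K(u) for all u). Let f : ℝ → ℝ be twice differentiable with |f''(x)| ≤ M for all x. Then for every p ∈ ℝ and every h > 0, |(1/h)·∫_ℝ K((x − p)/h)·(x − p)²·f(x) dx − h²·f(p)·∫_ℝ u²K(u) du| ≤ (M h⁴/2)·∫_ℝ u⁴|K(u)| du. -/

import Mathlib

open MeasureTheory

/-- A function with nonnegative second derivative is minimal at a critical point `p`. -/
lemma le_of_hasDerivAt_eq_zero_of_second_deriv_nonneg {g g' g'' : ℝ → ℝ}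
    (hg : ∀ x, HasDerivAt g (g' x) x) (hg' : ∀ x, HasDerivAt g' (g'' x) x)
    (hnn : ∀ x, 0 ≤ g'' x) {p : ℝ} (hp : g' p = 0) (x : ℝ) : g p ≤ g x := by
  have hmono : Monotone g' := monotone_of_deriv_nonneg (fun x => (hg' x).differentiableAt)
    (fun x => by rw [(hg' x).deriv]; exact hnn x)
  have hcont : Continuous g := continuous_iff_continuousAt.2 fun x => (hg x).continuousAt
  rcases lt_trichotomy p x with hx | rfl | hx
  · obtain ⟨c, hc, hs⟩ := exists_hasDerivAt_eq_slope g g' hx hcont.continuousOn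
      (fun y _ => hg y)
    have hc0 : 0 ≤ g' c := hp ▸ hmono hc.1.le
    rw [eq_div_iff (sub_pos.2 hx).ne'] at hs
    nlinarith [mul_nonneg hc0 (sub_pos.2 hx).le]
  · exact le_rfl
  · obtain ⟨c, hc, hs⟩ := exists_hasDerivAt_eq_slope g g' hx hcont.continuousOn
      (fun y _ => hg y)
    have hc0 : g' c ≤ 0 := hp ▸ hmono hc.2.le
    rw [eq_div_iff (sub_pos.2 hx).ne'] at hs
    nlinarith [mul_nonneg (neg_nonneg.2 hc0) (sub_pos.2 hx).le]

/-- One-sided second-order Taylor bound. -/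
lemma taylor_two_le {f f' f'' : ℝ → ℝ} (hf' : ∀ x, HasDerivAt f (f' x) x)
    (hf'' : ∀ x, HasDerivAt f' (f'' x) x) {M : ℝ} (hM : ∀ x, f'' x ≤ M) (p x : ℝ) :
    f x - f p - f' p * (x - p) ≤ M / 2 * (x - p) ^ 2 := by
  have h1 : ∀ y, HasDerivAt (fun y => M / 2 * (y - p) ^ 2 + f' p * (y - p) - f y)
      (M * (y - p) + f' p - f' y) y := fun y => by
    have h0 : HasDerivAt (fun y : ℝ => y - p) 1 y := (hasDerivAt_id y).sub_const p
    refine ((((h0.pow 2).const_mul (M / 2)).add (h0.const_mul (f' p))).sub (hf' y)).congr_deriv ?_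
    norm_num
    ring
  have h2 : ∀ y, HasDerivAt (fun y => M * (y - p) + f' p - f' y) (M - f'' y) y := fun y => by
    have h0 : HasDerivAt (fun y : ℝ => y - p) 1 y := (hasDerivAt_id y).sub_const p
    refine (((h0.const_mul M).add_const (f' p)).sub (hf'' y)).congr_deriv ?_
    ring
  have h3 := le_of_hasDerivAt_eq_zero_of_second_deriv_nonneg h1 h2 (fun y => sub_nonneg.2 (hM y))
    (p := p) (by simp) x
  simp only [sub_self] at h3
  linarith

/-- Two-sided second-order Taylor bound. -/
lemma abs_taylor_two_le {f f' f'' : ℝ → ℝ} (hf' : ∀ x, HasDerivAt f (f' x) x)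
    (hf'' : ∀ x, HasDerivAt f' (f'' x) x) {M : ℝ} (hM : ∀ x, |f'' x| ≤ M) (p x : ℝ) :
    |f x - f p - f' p * (x - p)| ≤ M / 2 * (x - p) ^ 2 := by
  have h1 := taylor_two_le hf' hf'' (fun x => (abs_le.1 (hM x)).2) p x
  have h2 := taylor_two_le (f := fun x => -f x) (f' := fun x => -f' x) (f'' := fun x => -f'' x)
    (fun x => (hf' x).neg) (fun x => (hf'' x).neg)
    (fun x => neg_le.1 (abs_le.1 (hM x)).1) p x
  exact abs_le.2 ⟨by linarith, h1⟩

/-- A continuous function times a bounded measurable compactly supported one is integrable. -/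
lemma integrable_continuous_mul_of_hasCompactSupport {K g : ℝ → ℝ} (hKmeas : Measurable K)
    (hKbd : ∃ C : ℝ, ∀ u, |K u| ≤ C) (hKsupp : HasCompactSupport K) (hg : Continuous g) :
    Integrable (fun u => g u * K u) := by
  obtain ⟨C, hC⟩ := hKbd
  have hK : IntegrableOn K (tsupport K) :=
    Measure.integrableOn_of_bounded (M := C) hKsupp.isCompact.measure_lt_top.ne
      hKmeas.aestronglyMeasurable (Filter.Eventually.of_forall hC)
  refine (integrableOn_iff_integrable_of_support_subset ?_).1
    (hK.continuousOn_mul hg.continuousOn hKsupp.isCompact)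
  exact (Function.support_mul_subset_right g K).trans (subset_tsupport K)

/-- The change of variables `x = p + h * u`. -/
lemma integral_comp_sub_div (F : ℝ → ℝ) (p : ℝ) {h : ℝ} (hh : 0 < h) :
    ∫ x, F ((x - p) / h) = h * ∫ u, F u := by
  rw [integral_sub_right_eq_self (fun x => F (x / h)) p, Measure.integral_comp_div,
    abs_of_pos hh, smul_eq_mul]

/-- bias expansion for the kernel-weighted second moment.
For a bounded, compactly supported, symmetric measurable kernel `K` and `f` twice
differentiable with `|f''| ≤ M`,
`|(1/h)·∫ K((x−p)/h)(x−p)² f(x) dx − h² f(p) ∫ u²K(u) du| ≤ (M h⁴/2)·∫ u⁴|K(u)| du`. -/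
theorem stmt_14 (K : ℝ → ℝ) (hKmeas : Measurable K) (hKbd : ∃ C : ℝ, ∀ u, |K u| ≤ C)
    (hKsupp : HasCompactSupport K) (hKsymm : ∀ u, K (-u) = K u)
    (f f' f'' : ℝ → ℝ)
    (hf' : ∀ x, HasDerivAt f (f' x) x) (hf'' : ∀ x, HasDerivAt f' (f'' x) x)
    (M : ℝ) (hM : ∀ x, |f'' x| ≤ M)
    (p h : ℝ) (hh : 0 < h) :
    |(1 / h) * (∫ x, K ((x - p) / h) * (x - p) ^ 2 * f x)
        - h ^ 2 * f p * ∫ u, u ^ 2 * K u|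
      ≤ M * h ^ 4 / 2 * ∫ u, u ^ 4 * |K u| := by
  have hint {g : ℝ → ℝ} (hg : Continuous g) : Integrable (fun u => g u * K u) :=
    integrable_continuous_mul_of_hasCompactSupport hKmeas hKbd hKsupp hg
  have hfc : Continuous f := continuous_iff_continuousAt.2 fun x => (hf' x).continuousAt
  have hchange : (1 / h) * (∫ x, K ((x - p) / h) * (x - p) ^ 2 * f x)
      = ∫ u, ((h * u) ^ 2 * f (p + h * u)) * K u := by
    have hcv := integral_comp_sub_div (fun u => ((h * u) ^ 2 * f (p + h * u)) * K u) p hh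
    have hpt : (fun x => K ((x - p) / h) * (x - p) ^ 2 * f x) = fun x =>
        ((h * ((x - p) / h)) ^ 2 * f (p + h * ((x - p) / h))) * K ((x - p) / h) := by
      funext x
      rw [mul_div_cancel₀ _ hh.ne', add_sub_cancel]
      ring
    rw [hpt, hcv, ← mul_assoc, one_div_mul_cancel hh.ne', one_mul]
  have hodd : ∫ u, u ^ 3 * K u = 0 := by
    have h1 := integral_neg_eq_self (fun u : ℝ => u ^ 3 * K u) volume
    have h2 : (fun u : ℝ => (-u) ^ 3 * K (-u)) = fun u => -(u ^ 3 * K u) := by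
      funext u
      rw [hKsymm]
      ring
    rw [h2, integral_neg] at h1
    linarith
  have hi1 := hint (g := fun u => (h * u) ^ 2 * f (p + h * u)) (by fun_prop)
  have hi2 := (hint (g := fun u => u ^ 2) (by fun_prop)).const_mul (h ^ 2 * f p)
  have hi3 := (hint (g := fun u => u ^ 3) (by fun_prop)).const_mul (h ^ 3 * f' p)
  have hi4 : Integrable (fun u => u ^ 4 * |K u|) := by
    refine (hint (g := fun u => u ^ 4) (by fun_prop)).abs.congr (.of_forall fun u => ?_)
    simp only [abs_mul, abs_of_nonneg (show (0 : ℝ) ≤ u ^ 4 by positivity)]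
  have hrem : (1 / h) * (∫ x, K ((x - p) / h) * (x - p) ^ 2 * f x)
      - h ^ 2 * f p * ∫ u, u ^ 2 * K u
      = ∫ u, ((h * u) ^ 2 * f (p + h * u) * K u - h ^ 2 * f p * (u ^ 2 * K u)
          - h ^ 3 * f' p * (u ^ 3 * K u)) := by
    have hi12 : Integrable (fun u =>
        (h * u) ^ 2 * f (p + h * u) * K u - h ^ 2 * f p * (u ^ 2 * K u)) := hi1.sub hi2
    rw [integral_sub hi12 hi3, integral_sub hi1 hi2, integral_const_mul,
      integral_const_mul, hodd, hchange]
    ring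
  rw [hrem, ← integral_const_mul, ← Real.norm_eq_abs]
  refine norm_integral_le_of_norm_le (hi4.const_mul _) (.of_forall fun u => ?_)
  have ht := abs_taylor_two_le hf' hf'' hM p (p + h * u)
  rw [add_sub_cancel_left] at ht
  have hfac : (h * u) ^ 2 * f (p + h * u) * K u - h ^ 2 * f p * (u ^ 2 * K u)
      - h ^ 3 * f' p * (u ^ 3 * K u)
      = (h * u) ^ 2 * K u * (f (p + h * u) - f p - f' p * (h * u)) := by ring
  rw [Real.norm_eq_abs, hfac, abs_mul, abs_mul, abs_of_nonneg (sq_nonneg (h * u))]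
  calc (h * u) ^ 2 * |K u| * |f (p + h * u) - f p - f' p * (h * u)|
      ≤ (h * u) ^ 2 * |K u| * (M / 2 * (h * u) ^ 2) := by gcongr
    _ = M * h ^ 4 / 2 * (u ^ 4 * |K u|) := by ring
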